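/- The regular system R^{∇•} is sound and strongly complete with respect to the class of quasi-filters: for every set Γ ∪ {φ} of L(∇,•)-formulas, Γ ⊢_{R^{∇•}} φ if and only if every pointed model (M,s) with M a quasi-filter satisfying all members of Γ also satisfies φ. -/

import Mathlib

/-- The language L(∇,•) over propositional variables indexed by ℕ. -/
inductive Formula : Type
  | atom : ℕ → Formula
  | neg : Formula → Formula
  | and : Formula → Formula → Formula
  | nabla : Formula → Formula
  | bullet : Formula → Formula

namespace Formula

/-- Disjunction, defined from ¬ and ∧ as usual. -/
def or (φ ψ : Formula) : Formula := neg ((neg φ).and (neg ψ))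

/-- Implication, defined from ¬ and ∧ as usual. -/
def imp (φ ψ : Formula) : Formula := (neg φ).or ψ

/-- Biimplication, defined from ¬ and ∧ as usual. -/
def biimp (φ ψ : Formula) : Formula := (φ.imp ψ).and (ψ.imp φ)

/-- A fixed tautology ⊤. -/
def top : Formula := (atom 0).imp (atom 0)

/-- Δφ := ¬∇φ. -/
def delta (φ : Formula) : Formula := neg (nabla φ)

/-- ∘φ := ¬•φ. -/
def circ (φ : Formula) : Formula := neg (bullet φ)

end Formula

/-- A neighborhood model. -/
structure NbhdModel : Type 1 where
  S : Type
  ne : Nonempty S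
  N : S → Set (Set S)
  V : ℕ → Set S

namespace NbhdModel

/-- The truth set ⟦φ⟧_M of a formula in a neighborhood model. -/
def truthSet (M : NbhdModel) : Formula → Set M.S
  | .atom p => M.V p
  | .neg φ => (M.truthSet φ)ᶜ
  | .and φ ψ => M.truthSet φ ∩ M.truthSet ψ
  | .nabla φ => {s | M.truthSet φ ∉ M.N s ∧ (M.truthSet φ)ᶜ ∉ M.N s}
  | .bullet φ => {s | s ∈ M.truthSet φ ∧ M.truthSet φ ∉ M.N s}

/-- M,s ⊨ φ. -/
def Sat (M : NbhdModel) (s : M.S) (φ : Formula) : Prop := s ∈ M.truthSet φ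

/-- Property (n): N(s) contains the unit. -/
def PropN (M : NbhdModel) : Prop := ∀ s : M.S, (Set.univ : Set M.S) ∈ M.N s

/-- Property (r): N(s) contains its core. -/
def PropR (M : NbhdModel) : Prop := ∀ s : M.S, ⋂₀ (M.N s) ∈ M.N s

/-- Property (i): N(s) is closed under binary intersections. -/
def PropI (M : NbhdModel) : Prop :=
  ∀ (s : M.S) (X Y : Set M.S), X ∈ M.N s → Y ∈ M.N s → X ∩ Y ∈ M.N s

/-- Property (s): N(s) is supplemented (closed under supersets). -/
def PropS (M : NbhdModel) : Prop :=
  ∀ (s : M.S) (X Y : Set M.S), X ∈ M.N s → X ⊆ Y → Y ∈ M.N s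

/-- Property (c): N(s) is closed under complements. -/
def PropC (M : NbhdModel) : Prop :=
  ∀ (s : M.S) (X : Set M.S), X ∈ M.N s → Xᶜ ∈ M.N s

/-- Property (d). -/
def PropD (M : NbhdModel) : Prop :=
  ∀ (s : M.S) (X : Set M.S), X ∈ M.N s → Xᶜ ∉ M.N s

/-- Property (t). -/
def PropT (M : NbhdModel) : Prop :=
  ∀ (s : M.S) (X : Set M.S), X ∈ M.N s → s ∈ X

/-- Property (b). -/
def PropB (M : NbhdModel) : Prop :=
  ∀ (s : M.S) (X : Set M.S), s ∈ X → {u : M.S | Xᶜ ∉ M.N u} ∈ M.N s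

/-- Property (4). -/
def Prop4 (M : NbhdModel) : Prop :=
  ∀ (s : M.S) (X : Set M.S), X ∈ M.N s → {u : M.S | X ∈ M.N u} ∈ M.N s

/-- Property (5). -/
def Prop5 (M : NbhdModel) : Prop :=
  ∀ (s : M.S) (X : Set M.S), X ∉ M.N s → {u : M.S | X ∉ M.N u} ∈ M.N s

end NbhdModel

/-- φ is an instance of a propositional tautology (treating ∇ψ and •ψ subformulas
as atoms): every Boolean valuation that respects ¬ and ∧ makes φ true. -/
def IsTautology (φ : Formula) : Prop :=
  ∀ v : Formula → Bool,
    (∀ ψ : Formula, v ψ.neg = !v ψ) →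
    (∀ ψ χ : Formula, v (ψ.and χ) = (v ψ && v χ)) →
    v φ = true

/-- Theorems of the system E^{∇•} extended with the extra axioms in `Ax`:
all tautology instances, E1, E2, E3, the members of `Ax`, closed under
modus ponens, RE∇ and RE•. -/
inductive Prf (Ax : Set Formula) : Formula → Prop
  | taut {φ : Formula} : IsTautology φ → Prf Ax φ
  | e1 (φ : Formula) : Prf Ax ((Formula.nabla φ).biimp (Formula.nabla φ.neg))
  | e2 (φ : Formula) : Prf Ax ((Formula.bullet φ).imp φ)
  | e3 (φ : Formula) :
      Prf Ax ((Formula.nabla φ).imp ((Formula.bullet φ).or (Formula.bullet φ.neg)))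
  | ax {φ : Formula} : φ ∈ Ax → Prf Ax φ
  | mp {φ ψ : Formula} : Prf Ax (φ.imp ψ) → Prf Ax φ → Prf Ax ψ
  | reN {φ ψ : Formula} :
      Prf Ax (φ.biimp ψ) → Prf Ax ((Formula.nabla φ).biimp (Formula.nabla ψ))
  | reB {φ ψ : Formula} :
      Prf Ax (φ.biimp ψ) → Prf Ax ((Formula.bullet φ).biimp (Formula.bullet ψ))

/-- Γ ⊢_Λ φ: derivable from theorems of the system together with members of Γ
by modus ponens. -/
inductive Deriv (Ax : Set Formula) (Γ : Set Formula) : Formula → Prop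
  | thm {φ : Formula} : Prf Ax φ → Deriv Ax Γ φ
  | prem {φ : Formula} : φ ∈ Γ → Deriv Ax Γ φ
  | mp {φ ψ : Formula} : Deriv Ax Γ (φ.imp ψ) → Deriv Ax Γ φ → Deriv Ax Γ ψ

/-- No extra axioms: the system E^{∇•}. -/
def EAx : Set Formula := ∅

/-- Extra axiom E4: •φ → ∇φ (all instances); E^{∇•} plus these is E_c^{∇•}. -/
def EcAx : Set Formula := {α | ∃ φ : Formula, α = (Formula.bullet φ).imp (Formula.nabla φ)}

/-- Extra axiom ∘⊤; E^{∇•} plus this is EN^{∇•}. -/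
def ENAx : Set Formula := {Formula.top.bullet.neg}

/-- Extra axioms M1–M4 (all instances); E^{∇•} plus these is M^{∇•}. -/
def MAx : Set Formula :=
  {α | ∃ φ ψ χ : Formula,
      α = ((Formula.nabla (φ.or ψ)).and (Formula.nabla (φ.neg.or χ))).imp (Formula.nabla φ)} ∪
  {α | ∃ φ ψ χ : Formula,
      α = ((Formula.bullet (φ.or ψ)).and (Formula.bullet (φ.neg.or χ))).imp (Formula.nabla φ)} ∪
  {α | ∃ φ ψ χ : Formula,
      α = ((Formula.bullet (φ.or ψ)).and (Formula.nabla (φ.neg.or χ))).imp (Formula.nabla φ)} ∪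
  {α | ∃ φ ψ : Formula,
      α = (φ.circ.and φ).imp ((Formula.delta (φ.or ψ)).and (Formula.circ (φ.or ψ)))}

/-- Extra axioms of R^{∇•}: those of M^{∇•} plus R1 and R2 (all instances). -/
def RAx : Set Formula :=
  MAx ∪
  {α | ∃ φ ψ : Formula,
      α = ((Formula.delta φ).and (Formula.delta ψ)).imp (Formula.delta (φ.and ψ))} ∪
  {α | ∃ φ ψ : Formula,
      α = ((Formula.circ φ).and (Formula.circ ψ)).imp (Formula.circ (φ.and ψ))}

/-- Extra axioms of K^{∇•}: those of R^{∇•} plus ∘⊤. -/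
def KAx : Set Formula := RAx ∪ {Formula.top.bullet.neg}

/-! ### Truth conditions for the defined connectives -/

namespace NbhdModel

variable (M : NbhdModel) (s : M.S) (φ ψ : Formula)

@[simp] theorem sat_neg : M.Sat s φ.neg ↔ ¬ M.Sat s φ := Iff.rfl

@[simp] theorem sat_and : M.Sat s (φ.and ψ) ↔ M.Sat s φ ∧ M.Sat s ψ := Iff.rfl

@[simp] theorem sat_nabla :
    M.Sat s φ.nabla ↔ M.truthSet φ ∉ M.N s ∧ (M.truthSet φ)ᶜ ∉ M.N s := Iff.rfl

@[simp] theorem sat_bullet : M.Sat s φ.bullet ↔ M.Sat s φ ∧ M.truthSet φ ∉ M.N s := Iff.rfl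

@[simp] theorem sat_or : M.Sat s (φ.or ψ) ↔ M.Sat s φ ∨ M.Sat s ψ := by
  simp [Formula.or]; tauto

@[simp] theorem sat_imp : M.Sat s (φ.imp ψ) ↔ (M.Sat s φ → M.Sat s ψ) := by
  simp [Formula.imp]; tauto

@[simp] theorem sat_biimp : M.Sat s (φ.biimp ψ) ↔ (M.Sat s φ ↔ M.Sat s ψ) := by
  simp [Formula.biimp]; tauto

@[simp] theorem sat_delta : M.Sat s φ.delta ↔ ¬ M.Sat s φ.nabla := Iff.rfl

@[simp] theorem sat_circ : M.Sat s φ.circ ↔ ¬ M.Sat s φ.bullet := Iff.rfl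

@[simp] theorem truthSet_neg : M.truthSet φ.neg = (M.truthSet φ)ᶜ := rfl

@[simp] theorem truthSet_and : M.truthSet (φ.and ψ) = M.truthSet φ ∩ M.truthSet ψ := rfl

@[simp] theorem truthSet_or : M.truthSet (φ.or ψ) = M.truthSet φ ∪ M.truthSet ψ := by
  ext t; exact M.sat_or t φ ψ

end NbhdModel

/-! ### Soundness -/

theorem IsTautology.sat {φ : Formula} (h : IsTautology φ) (M : NbhdModel) (s : M.S) :
    M.Sat s φ := by
  classical
  simpa using h (fun ψ => decide (M.Sat s ψ)) (by simp) (by simp)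

theorem Prf.sat {Ax : Set Formula} {M : NbhdModel} (hAx : ∀ α ∈ Ax, ∀ s, M.Sat s α)
    {φ : Formula} (h : Prf Ax φ) (s : M.S) : M.Sat s φ := by
  induction h generalizing s with
  | taut h => exact h.sat M s
  | e1 φ => simp; tauto
  | e2 φ => simp; tauto
  | e3 φ => simp; tauto
  | ax h => exact hAx _ h s
  | mp _ _ ih₁ ih₂ => exact (M.sat_imp s _ _).1 (ih₁ s) (ih₂ s)
  | @reN φ ψ _ ih =>
    have : M.truthSet φ = M.truthSet ψ := Set.ext fun t => (M.sat_biimp t _ _).1 (ih t)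
    simp [this]
  | @reB φ ψ _ ih =>
    have : M.truthSet φ = M.truthSet ψ := Set.ext fun t => (M.sat_biimp t _ _).1 (ih t)
    have hs := (M.sat_biimp s _ _).1 (ih s)
    simp [this, hs]

theorem Deriv.sat {Ax Γ : Set Formula} {M : NbhdModel} (hAx : ∀ α ∈ Ax, ∀ s, M.Sat s α)
    {φ : Formula} (h : Deriv Ax Γ φ) (s : M.S) (hΓ : ∀ γ ∈ Γ, M.Sat s γ) : M.Sat s φ := by
  induction h with
  | thm h => exact h.sat hAx s
  | prem h => exact hΓ _ h
  | mp _ _ ih₁ ih₂ => exact (M.sat_imp s _ _).1 ih₁ ih₂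

theorem MAx.sat {M : NbhdModel} (hS : M.PropS) {α : Formula} (hα : α ∈ MAx) (s : M.S) :
    M.Sat s α := by
  have up_left (X Y : Set M.S) (h : X ∈ M.N s) : X ∪ Y ∈ M.N s :=
    hS s X _ h Set.subset_union_left
  rcases hα with ((⟨φ, ψ, χ, rfl⟩ | ⟨φ, ψ, χ, rfl⟩) | ⟨φ, ψ, χ, rfl⟩) | ⟨φ, ψ, rfl⟩
  · simp only [NbhdModel.sat_imp, NbhdModel.sat_and, NbhdModel.sat_nabla,
      NbhdModel.truthSet_or, NbhdModel.truthSet_neg]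
    rintro ⟨⟨h₁, -⟩, ⟨h₂, -⟩⟩
    exact ⟨fun h => h₁ (up_left _ _ h), fun h => h₂ (up_left _ _ h)⟩
  · simp only [NbhdModel.sat_imp, NbhdModel.sat_and, NbhdModel.sat_nabla, NbhdModel.sat_bullet,
      NbhdModel.truthSet_or, NbhdModel.truthSet_neg]
    rintro ⟨⟨-, h₁⟩, ⟨-, h₂⟩⟩
    exact ⟨fun h => h₁ (up_left _ _ h), fun h => h₂ (up_left _ _ h)⟩
  · simp only [NbhdModel.sat_imp, NbhdModel.sat_and, NbhdModel.sat_nabla, NbhdModel.sat_bullet,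
      NbhdModel.truthSet_or, NbhdModel.truthSet_neg]
    rintro ⟨⟨-, h₁⟩, ⟨h₂, -⟩⟩
    exact ⟨fun h => h₁ (up_left _ _ h), fun h => h₂ (up_left _ _ h)⟩
  · have := up_left (M.truthSet φ) (M.truthSet ψ)
    simp
    tauto

theorem RAx.sat {M : NbhdModel} (hI : M.PropI) (hS : M.PropS) {α : Formula} (hα : α ∈ RAx)
    (s : M.S) : M.Sat s α := by
  rcases hα with (hα | ⟨φ, ψ, rfl⟩) | ⟨φ, ψ, rfl⟩
  · exact MAx.sat hS hα s
  · have h := hI s (M.truthSet φ) (M.truthSet ψ)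
    have h₁ := hS s (M.truthSet φ)ᶜ (M.truthSet φ ∩ M.truthSet ψ)ᶜ
    have h₂ := hS s (M.truthSet ψ)ᶜ (M.truthSet φ ∩ M.truthSet ψ)ᶜ
    simp only [Set.compl_subset_compl, Set.inter_subset_left, Set.inter_subset_right] at h₁ h₂
    simp only [NbhdModel.sat_imp, NbhdModel.sat_and, NbhdModel.sat_delta, NbhdModel.sat_nabla,
      NbhdModel.truthSet_and]
    tauto
  · have h := hI s (M.truthSet φ) (M.truthSet ψ)
    simp only [NbhdModel.sat_imp, NbhdModel.sat_and, NbhdModel.sat_circ, NbhdModel.sat_bullet,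
      NbhdModel.truthSet_and]
    tauto

/-! ### Derivability -/

theorem IsTautology.imp_self (φ : Formula) : IsTautology (φ.imp φ) := by
  intro v hn ha; simp [Formula.imp, Formula.or, hn, ha]

theorem IsTautology.imp_intro (φ ψ : Formula) : IsTautology (φ.imp (ψ.imp φ)) := by
  intro v hn ha; simp [Formula.imp, Formula.or, hn, ha]; grind

theorem IsTautology.imp_distrib (φ ψ χ : Formula) :
    IsTautology ((φ.imp (ψ.imp χ)).imp ((φ.imp ψ).imp (φ.imp χ))) := by
  intro v hn ha; simp [Formula.imp, Formula.or, hn, ha]; grind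

theorem IsTautology.imp_of_neg (φ ψ : Formula) : IsTautology (φ.neg.imp (φ.imp ψ)) := by
  intro v hn ha; simp [Formula.imp, Formula.or, hn, ha]; grind

theorem IsTautology.imp_by_cases (φ ψ : Formula) :
    IsTautology ((φ.imp ψ).imp ((φ.neg.imp ψ).imp ψ)) := by
  intro v hn ha; simp [Formula.imp, Formula.or, hn, ha]; grind

theorem IsTautology.and_intro (φ ψ : Formula) : IsTautology (φ.imp (ψ.imp (φ.and ψ))) := by
  intro v hn ha; simp [Formula.imp, Formula.or, hn, ha]; grind

theorem IsTautology.and_left (φ ψ : Formula) : IsTautology ((φ.and ψ).imp φ) := by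
  intro v hn ha; simp [Formula.imp, Formula.or, hn, ha]; grind

theorem IsTautology.and_right (φ ψ : Formula) : IsTautology ((φ.and ψ).imp ψ) := by
  intro v hn ha; simp [Formula.imp, Formula.or, hn, ha]; grind

namespace Deriv

variable {Ax Γ T : Set Formula} {φ ψ χ : Formula}

theorem mono (h : Deriv Ax Γ φ) (hΓ : Γ ⊆ T) : Deriv Ax T φ := by
  induction h with
  | thm h => exact thm h
  | prem h => exact prem (hΓ h)
  | mp _ _ ih₁ ih₂ => exact mp ih₁ ih₂

theorem taut (h : IsTautology φ) : Deriv Ax Γ φ := thm (.taut h)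

theorem mp_taut (h : IsTautology (φ.imp ψ)) (hφ : Deriv Ax Γ φ) : Deriv Ax Γ ψ :=
  mp (taut h) hφ

theorem mp_taut₂ (h : IsTautology (φ.imp (ψ.imp χ))) (hφ : Deriv Ax Γ φ)
    (hψ : Deriv Ax Γ ψ) : Deriv Ax Γ χ :=
  mp (mp_taut h hφ) hψ

theorem prf_of_empty (h : Deriv Ax ∅ φ) : Prf Ax φ := by
  induction h with
  | thm h => exact h
  | prem h => exact h.elim
  | mp _ _ ih₁ ih₂ => exact .mp ih₁ ih₂

theorem deduction (h : Deriv Ax (insert ψ Γ) φ) : Deriv Ax Γ (ψ.imp φ) := by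
  induction h with
  | thm h => exact mp_taut (.imp_intro _ _) (thm h)
  | prem h =>
    rcases h with rfl | h
    · exact taut (.imp_self _)
    · exact mp_taut (.imp_intro _ _) (prem h)
  | mp _ _ ih₁ ih₂ => exact mp_taut₂ (.imp_distrib _ _ _) ih₁ ih₂

theorem exists_mem_of_sUnion {c : Set (Set Formula)} (hc : IsChain (· ⊆ ·) c)
    (hne : c.Nonempty) (h : Deriv Ax (⋃₀ c) φ) : ∃ t ∈ c, Deriv Ax t φ := by
  induction h with
  | thm h => exact hne.imp fun _ ht => ⟨ht, thm h⟩
  | prem h => exact h.imp fun _ ht => ⟨ht.1, prem ht.2⟩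
  | mp _ _ ih₁ ih₂ =>
    obtain ⟨t, ht, h₁⟩ := ih₁
    obtain ⟨u, hu, h₂⟩ := ih₂
    rcases hc.total ht hu with htu | hut
    · exact ⟨u, hu, mp (h₁.mono htu) h₂⟩
    · exact ⟨t, ht, mp h₁ (h₂.mono hut)⟩

end Deriv

/-! ### Maximal consistent sets -/

/-- A maximal consistent set of the system `Ax`: a deductively closed set of formulas that
contains exactly one of `φ` and `¬φ`, for every `φ`. -/
structure MaxConsistent (Ax : Set Formula) : Type where
  carrier : Set Formula
  closed' : ∀ φ, Deriv Ax carrier φ → φ ∈ carrier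
  neg_mem' : ∀ φ, φ.neg ∈ carrier ↔ φ ∉ carrier

namespace MaxConsistent

variable {Ax Γ : Set Formula} {φ ψ χ : Formula}

instance : Membership Formula (MaxConsistent Ax) := ⟨fun s φ => φ ∈ s.carrier⟩

theorem closed {s : MaxConsistent Ax} (h : Deriv Ax s.carrier φ) : φ ∈ s := s.closed' φ h

variable (s : MaxConsistent Ax)

@[simp] theorem neg_mem : φ.neg ∈ s ↔ φ ∉ s := s.neg_mem' φ

@[simp] theorem and_mem : φ.and ψ ∈ s ↔ φ ∈ s ∧ ψ ∈ s :=
  ⟨fun h => ⟨closed (.mp_taut (.and_left _ _) (.prem h)),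
    closed (.mp_taut (.and_right _ _) (.prem h))⟩,
    fun h => closed (.mp_taut₂ (.and_intro _ _) (.prem h.1) (.prem h.2))⟩

@[simp] theorem or_mem : φ.or ψ ∈ s ↔ φ ∈ s ∨ ψ ∈ s := by
  simp [Formula.or]; tauto

@[simp] theorem imp_mem : φ.imp ψ ∈ s ↔ (φ ∈ s → ψ ∈ s) := by
  simp [Formula.imp]; tauto

@[simp] theorem biimp_mem : φ.biimp ψ ∈ s ↔ (φ ∈ s ↔ ψ ∈ s) := by
  simp [Formula.biimp]; tauto

@[simp] theorem delta_mem : φ.delta ∈ s ↔ φ.nabla ∉ s := s.neg_mem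

@[simp] theorem circ_mem : φ.circ ∈ s ↔ φ.bullet ∉ s := s.neg_mem

theorem mem_of_prf (h : Prf Ax φ) : φ ∈ s := closed (.thm h)

/-- Lindenbaum's lemma. -/
theorem exists_not_mem (h : ¬ Deriv Ax Γ φ) : ∃ s : MaxConsistent Ax, Γ ⊆ s.carrier ∧ φ ∉ s := by
  obtain ⟨T, hΓT, hT⟩ := zorn_subset_nonempty {T | ¬ Deriv Ax T φ}
    (fun c hcS hc hne => ⟨⋃₀ c, fun hd => by
      obtain ⟨t, ht, h'⟩ := hd.exists_mem_of_sUnion hc hne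
      exact hcS ht h', fun _ => Set.subset_sUnion_of_mem⟩) Γ h
  have hTφ : ¬ Deriv Ax T φ := hT.prop
  have mem_or (ψ : Formula) : ψ ∈ T ∨ Deriv Ax T (ψ.imp φ) := by
    by_contra! hcon
    exact hcon.1 (hT.le_of_ge (y := insert ψ T) (fun hd => hcon.2 hd.deduction)
      (Set.subset_insert _ _) (Set.mem_insert _ _))
  refine ⟨⟨T, fun ψ hψ => (mem_or ψ).resolve_right fun h' => hTφ (.mp h' hψ),
    fun ψ => ⟨fun hn hp => hTφ (.mp_taut₂ (.imp_of_neg _ _) (.prem hn) (.prem hp)),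
      fun hn => (mem_or _).resolve_right fun h' =>
        hTφ (.mp_taut₂ (.imp_by_cases _ _) ((mem_or ψ).resolve_left hn) h')⟩⟩,
    hΓT, fun hφ => hTφ (.prem hφ)⟩

theorem prf_of_forall_mem (h : ∀ s : MaxConsistent Ax, φ ∈ s) : Prf Ax φ := by
  by_contra hn
  obtain ⟨s, -, hs⟩ := exists_not_mem (Γ := ∅) fun hd => hn hd.prf_of_empty
  exact hs (h s)

theorem nabla_congr (h : ∀ t : MaxConsistent Ax, φ ∈ t ↔ ψ ∈ t) :
    φ.nabla ∈ s ↔ ψ.nabla ∈ s :=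
  s.biimp_mem.1 (s.mem_of_prf (.reN (prf_of_forall_mem fun t => t.biimp_mem.2 (h t))))

theorem bullet_congr (h : ∀ t : MaxConsistent Ax, φ ∈ t ↔ ψ ∈ t) :
    φ.bullet ∈ s ↔ ψ.bullet ∈ s :=
  s.biimp_mem.1 (s.mem_of_prf (.reB (prf_of_forall_mem fun t => t.biimp_mem.2 (h t))))

theorem nabla_neg_mem : φ.neg.nabla ∈ s ↔ φ.nabla ∈ s :=
  (s.biimp_mem.1 (s.mem_of_prf (.e1 φ))).symm

theorem mem_of_bullet_mem (h : φ.bullet ∈ s) : φ ∈ s :=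
  s.imp_mem.1 (s.mem_of_prf (.e2 φ)) h

/-! ### The canonical model -/

/-- The formula `φ` is robustly necessary at `s`: every weakening `φ ∨ ψ` is both non-contingent
and not accidentally true. -/
def Robust (φ : Formula) : Prop :=
  ∀ ψ : Formula, (φ.or ψ).nabla ∉ s ∧ (φ.or ψ).bullet ∉ s

variable {s}

theorem Robust.nabla_notMem (h : s.Robust φ) (hle : ∀ t : MaxConsistent Ax, φ ∈ t → ψ ∈ t) :
    ψ.nabla ∉ s := fun hψ =>
  (h ψ).1 <| (s.nabla_congr fun t => by simpa using hle t).2 hψ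

theorem Robust.bullet_notMem (h : s.Robust φ) (hle : ∀ t : MaxConsistent Ax, φ ∈ t → ψ ∈ t) :
    ψ.bullet ∉ s := fun hψ =>
  (h ψ).2 <| (s.bullet_congr fun t => by simpa using hle t).2 hψ

theorem Robust.and {s : MaxConsistent RAx} (hφ : s.Robust φ) (hψ : s.Robust ψ) :
    s.Robust (φ.and ψ) := by
  intro χ
  have hcongr (t : MaxConsistent RAx) :
      (φ.and ψ).or χ ∈ t ↔ (φ.or χ).and (ψ.or χ) ∈ t := by
    simp; tauto
  rw [s.nabla_congr hcongr, s.bullet_congr hcongr]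
  have h₁ := s.mem_of_prf (.ax (Or.inl (Or.inr ⟨φ.or χ, ψ.or χ, rfl⟩)))
  have h₂ := s.mem_of_prf (.ax (Or.inr ⟨φ.or χ, ψ.or χ, rfl⟩))
  simp only [imp_mem, and_mem, delta_mem, circ_mem] at h₁ h₂
  exact ⟨h₁ ⟨(hφ χ).1, (hψ χ).1⟩, h₂ ⟨(hφ χ).2, (hψ χ).2⟩⟩

theorem robust_of_bullet_notMem {s : MaxConsistent RAx} (hφ : φ ∈ s) (h : φ.bullet ∉ s) :
    s.Robust φ := by
  intro ψ
  have h₄ := s.mem_of_prf (.ax (Or.inl (Or.inl (Or.inr ⟨φ, ψ, rfl⟩))))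
  simp only [imp_mem, and_mem, delta_mem, circ_mem] at h₄
  exact h₄ ⟨h, hφ⟩

theorem robust_or_robust_neg {s : MaxConsistent RAx} (h : φ.nabla ∉ s) :
    s.Robust φ ∨ s.Robust φ.neg := by
  by_contra! hcon
  simp only [Robust, not_forall, not_and_or, not_not] at hcon
  obtain ⟨⟨ψ, hψ⟩, ⟨χ, hχ⟩⟩ := hcon
  have m₁ := s.mem_of_prf (.ax (Or.inl (Or.inl (Or.inl (Or.inl (Or.inl ⟨φ, ψ, χ, rfl⟩))))))
  have m₂ := s.mem_of_prf (.ax (Or.inl (Or.inl (Or.inl (Or.inl (Or.inr ⟨φ, ψ, χ, rfl⟩))))))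
  have m₃ := s.mem_of_prf (.ax (Or.inl (Or.inl (Or.inl (Or.inr ⟨φ, ψ, χ, rfl⟩)))))
  have m₃' := s.mem_of_prf (.ax (Or.inl (Or.inl (Or.inl (Or.inr ⟨φ.neg, χ, ψ, rfl⟩)))))
  have hcongr : (φ.neg.neg.or ψ).nabla ∈ s ↔ (φ.or ψ).nabla ∈ s :=
    s.nabla_congr fun t => by simp
  simp only [imp_mem, and_mem, hcongr, nabla_neg_mem] at m₁ m₂ m₃ m₃'
  tauto

/-- The canonical quasi-filter model of `R`, based at a given maximal consistent set. -/
def canonicalModel (s₀ : MaxConsistent RAx) : NbhdModel where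
  S := MaxConsistent RAx
  ne := ⟨s₀⟩
  N s := {X | ∃ φ : Formula, s.Robust φ ∧ {t : MaxConsistent RAx | φ ∈ t} ⊆ X}
  V p := {s | Formula.atom p ∈ s}

theorem canonicalModel_propI (s₀ : MaxConsistent RAx) : (canonicalModel s₀).PropI := by
  rintro s X Y ⟨φ, hφ, hX⟩ ⟨ψ, hψ, hY⟩
  refine ⟨φ.and ψ, hφ.and hψ, fun t ht => ?_⟩
  have ht' := t.and_mem.1 ht
  exact ⟨hX ht'.1, hY ht'.2⟩

theorem canonicalModel_propS (s₀ : MaxConsistent RAx) : (canonicalModel s₀).PropS := by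
  rintro s X Y ⟨φ, hφ, hX⟩ hXY
  exact ⟨φ, hφ, hX.trans hXY⟩

/-- The truth lemma. -/
theorem truthSet_canonicalModel (s₀ : MaxConsistent RAx) (φ : Formula) :
    (canonicalModel s₀).truthSet φ = {s : MaxConsistent RAx | φ ∈ s} := by
  induction φ with
  | atom p => rfl
  | neg φ ih =>
    rw [NbhdModel.truthSet, ih]
    exact Set.ext fun s => s.neg_mem.symm
  | and φ ψ ih₁ ih₂ =>
    rw [NbhdModel.truthSet, ih₁, ih₂]
    exact Set.ext fun s => s.and_mem.symm
  | nabla φ ih =>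
    rw [NbhdModel.truthSet, ih]
    refine Set.ext fun s => ⟨fun h => ?_, fun h => ⟨?_, ?_⟩⟩
    · by_contra hn
      rcases robust_or_robust_neg hn with hr | hr
      · exact h.1 ⟨φ, hr, subset_rfl⟩
      · exact h.2 ⟨φ.neg, hr, fun t ht => t.neg_mem.1 ht⟩
    · rintro ⟨χ, hχ, hle⟩
      exact hχ.nabla_notMem (fun t ht => hle ht) h
    · rintro ⟨χ, hχ, hle⟩
      exact hχ.nabla_notMem (fun t ht => t.neg_mem.2 (hle ht)) (s.nabla_neg_mem.2 h)
  | bullet φ ih =>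
    rw [NbhdModel.truthSet, ih]
    refine Set.ext fun s => ⟨fun h => ?_, fun h => ⟨s.mem_of_bullet_mem h, ?_⟩⟩
    · by_contra hn
      exact h.2 ⟨φ, robust_of_bullet_notMem h.1 hn, subset_rfl⟩
    · rintro ⟨χ, hχ, hle⟩
      exact hχ.bullet_notMem (fun t ht => hle ht) h

theorem sat_canonicalModel (s₀ s : MaxConsistent RAx) (φ : Formula) :
    (canonicalModel s₀).Sat s φ ↔ φ ∈ s :=
  Set.ext_iff.1 (truthSet_canonicalModel s₀ φ) s

end MaxConsistent

/-- R^{∇•} is sound and strongly complete with respect to the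
class of quasi-filters. -/
theorem R_sound_and_strongly_complete (Γ : Set Formula) (φ : Formula) :
    Deriv RAx Γ φ ↔
      ∀ (M : NbhdModel), M.PropI → M.PropS →
        ∀ s : M.S, (∀ γ ∈ Γ, M.Sat s γ) → M.Sat s φ := by
  refine ⟨fun h M hI hS s hΓ => h.sat (fun α hα => RAx.sat hI hS hα) s hΓ, fun h => ?_⟩
  by_contra hn
  obtain ⟨s, hΓ, hφ⟩ := MaxConsistent.exists_not_mem hn
  have hsat := h (MaxConsistent.canonicalModel s) (MaxConsistent.canonicalModel_propI s)
    (MaxConsistent.canonicalModel_propS s) s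
    fun γ hγ => (MaxConsistent.sat_canonicalModel s s γ).2 (hΓ hγ)
  exact hφ ((MaxConsistent.sat_canonicalModel s s φ).1 hsat)
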